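/- arXiv:2211.15608 — 10 statements merged into one kernel-verified Lean document; each statement's English description precedes it below -/
import Mathlib

section
/- For any approval profile with n ≥ 1 voters, any finite committee W with Δ*(W) > 0, and any nonempty group of voters V ⊆ {1,…,n}, the average satisfaction satisfies avs_W(V) ≥ min{ |∩_{i∈V} A_i| , (1/n)·|V|/Δ*(W) − 1 }. -/
open Finset

/-- The PAV score of a committee `W`: `(1/n) · Σ_i Σ_{j=1}^{|A_i ∩ W|} 1/j`. -/
noncomputable def pavSc {C : Type*} [DecidableEq C] (n : ℕ) (A : Fin n → Finset C)
    (W : Finset C) : ℝ :=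
  (1 / (n : ℝ)) * ∑ i, ∑ j ∈ Finset.Icc 1 ((A i ∩ W).card), (1 : ℝ) / (j : ℝ)

/-- `Δ(W,c) := pav-sc(W ∪ {c}) − pav-sc(W)`. -/
noncomputable def delta {C : Type*} [DecidableEq C] (n : ℕ) (A : Fin n → Finset C)
    (W : Finset C) (c : C) : ℝ :=
  pavSc n A (insert c W) - pavSc n A W

/-- `Δ*(W) := max_{c ∈ C} Δ(W,c)`. -/
noncomputable def deltaStar {C : Type*} [DecidableEq C] [Fintype C] [Nonempty C]
    (n : ℕ) (A : Fin n → Finset C) (W : Finset C) : ℝ :=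
  Finset.univ.sup' Finset.univ_nonempty (delta n A W)

lemma delta_lower {C : Type*} [DecidableEq C]
    (n : ℕ) (A : Fin n → Finset C) (W : Finset C) (V : Finset (Fin n)) (c : C)
    (hc : ∀ i ∈ V, c ∈ A i) (hW : c ∉ W) :
    (1 / (n : ℝ)) * ∑ i ∈ V, (1 : ℝ) / (((A i ∩ W).card : ℝ) + 1) ≤ delta n A W c := by
  unfold delta pavSc
  rw [← mul_sub, ← Finset.sum_sub_distrib]
  apply mul_le_mul_of_nonneg_left _ (by positivity)
  have key : ∀ i, c ∈ A i → ∑ j ∈ Finset.Icc 1 ((A i ∩ insert c W).card), (1 : ℝ) / (j : ℝ)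
      - ∑ j ∈ Finset.Icc 1 ((A i ∩ W).card), (1 : ℝ) / (j : ℝ)
      = 1 / (((A i ∩ W).card : ℝ) + 1) := by
    intro i hi
    rw [Finset.inter_insert_of_mem hi, Finset.card_insert_of_notMem (by simp [hW]),
      Finset.sum_Icc_succ_top (by omega)]
    push_cast
    ring
  have h0 : ∀ i, 0 ≤ ∑ j ∈ Finset.Icc 1 ((A i ∩ insert c W).card), (1 : ℝ) / (j : ℝ)
      - ∑ j ∈ Finset.Icc 1 ((A i ∩ W).card), (1 : ℝ) / (j : ℝ) := by
    intro i
    by_cases hi : c ∈ A i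
    · rw [key i hi]; positivity
    · rw [Finset.inter_insert_of_notMem hi, sub_self]
  calc _ = ∑ i ∈ V, (∑ j ∈ Finset.Icc 1 ((A i ∩ insert c W).card), (1 : ℝ) / (j : ℝ)
      - ∑ j ∈ Finset.Icc 1 ((A i ∩ W).card), (1 : ℝ) / (j : ℝ)) :=
        Finset.sum_congr rfl fun i hi => (key i (hc i hi)).symm
    _ ≤ _ := Finset.sum_le_sum_of_subset_of_nonneg (Finset.subset_univ V) fun i _ _ => h0 i

/-- For any approval profile with `n ≥ 1` voters, any committee `W` with `Δ*(W) > 0`,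
and any nonempty group of voters `V`, the average satisfaction satisfies
`avs_W(V) ≥ min{ |∩_{i∈V} A_i| , (1/n)·|V|/Δ*(W) − 1 }`. -/
theorem avg_satisfaction_lower_bound {C : Type*} [DecidableEq C] [Fintype C] [Nonempty C]
    (n : ℕ) (hn : 1 ≤ n) (A : Fin n → Finset C) (W : Finset C)
    (hΔ : 0 < deltaStar n A W) (V : Finset (Fin n)) (hV : V.Nonempty) :
    min (((V.inf' hV A).card : ℝ))
        ((1 / (n : ℝ)) * (V.card : ℝ) / deltaStar n A W - 1)
      ≤ (1 / (V.card : ℝ)) * ∑ i ∈ V, ((A i ∩ W).card : ℝ) := by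
  have hv : (0 : ℝ) < V.card := by exact_mod_cast hV.card_pos
  have hn' : (0 : ℝ) < n := by exact_mod_cast hn
  by_cases hsub : V.inf' hV A ⊆ W
  · apply min_le_of_left_le
    rw [one_div, ← div_eq_inv_mul, le_div_iff₀ hv, mul_comm, ← nsmul_eq_mul]
    apply Finset.card_nsmul_le_sum
    intro i hi
    exact_mod_cast Finset.card_le_card
      (Finset.subset_inter (Finset.inf'_le A hi) hsub)
  · apply min_le_of_right_le
    obtain ⟨c, hc, hcW⟩ := Finset.not_subset.mp hsub
    have h1 := delta_lower n A W V c (fun i hi => (Finset.inf'_le A hi : _ ≤ A i) hc) hcW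
    have h2 : delta n A W c ≤ deltaStar n A W :=
      Finset.le_sup' (delta n A W) (Finset.mem_univ c)
    have h3 := Finset.sum_sq_le_sum_mul_sum_of_sq_eq_mul V (r := fun _ => (1 : ℝ))
      (f := fun i => (1 : ℝ) / (((A i ∩ W).card : ℝ) + 1))
      (g := fun i => ((A i ∩ W).card : ℝ) + 1)
      (fun i _ => by positivity) (fun i _ => by positivity) (fun i _ => by field_simp)
    simp only [Finset.sum_const, nsmul_eq_mul, mul_one, Finset.sum_add_distrib] at h3
    have hS : 0 ≤ ∑ i ∈ V, ((A i ∩ W).card : ℝ) := by positivity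
    generalize ∑ i ∈ V, ((A i ∩ W).card : ℝ) = S at *
    generalize ∑ i ∈ V, (1 : ℝ) / (((A i ∩ W).card : ℝ) + 1) = T at *
    generalize deltaStar n A W = D at *
    generalize (V.card : ℝ) = v at *
    have h4 : T ≤ n * D := by
      have := h1.trans h2
      rwa [one_div, inv_mul_le_iff₀ hn'] at this
    have h5 : v ^ 2 ≤ (n * D) * (S + v) :=
      h3.trans (mul_le_mul_of_nonneg_right h4 (by positivity))
    have h6 : v / (n * D) ≤ (S + v) / v := by
      rw [div_le_div_iff₀ (by positivity) hv]
      nlinarith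
    have e1 : 1 / (n : ℝ) * v / D = v / (n * D) := by field_simp
    have e2 : (S + v) / v = 1 / v * S + 1 := by field_simp
    rw [e1]
    linarith
end

section
/- Let 0 < α ≤ 1 and let W be a committee of size k ≥ 1. If Δ*(W) < 1/(αk), then W satisfies α-EJR; that is, for every integer ℓ ∈ {1,…,k} and every (ℓ/α)-large, ℓ-cohesive group of voters V, there exists a voter i ∈ V with |A_i ∩ W| ≥ ℓ. -/
open Finset

/-- If `Δ*(W) < 1/(αk)` for a committee `W` of size `k ≥ 1` and `0 < α ≤ 1`, then `W`
satisfies α-EJR: for every `ℓ ∈ {1,…,k}` and every `(ℓ/α)`-large, `ℓ`-cohesive group of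
voters `V`, some voter `i ∈ V` approves at least `ℓ` members of `W`. -/
theorem low_deltaStar_implies_alphaEJR {C : Type*} [DecidableEq C] [Fintype C] [Nonempty C]
    (n k : ℕ) (hn : 1 ≤ n) (hk : 1 ≤ k) (A : Fin n → Finset C)
    (W : Finset C) (hW : W.card = k)
    (α : ℝ) (hα0 : 0 < α) (hα1 : α ≤ 1)
    (hΔ : deltaStar n A W < 1 / (α * k)) :
    ∀ ℓ : ℕ, 1 ≤ ℓ → ℓ ≤ k → ∀ V : Finset (Fin n),
      ((ℓ : ℝ) / α) * (n : ℝ) / (k : ℝ) ≤ (V.card : ℝ) →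
      ℓ ≤ (V.inf A).card →
      ∃ i ∈ V, ℓ ≤ (A i ∩ W).card := by
  intro ℓ hl _ V hV hcoh
  by_contra hcon
  push Not at hcon
  have hn0 : (0 : ℝ) < n := by exact_mod_cast hn
  have hk0 : (0 : ℝ) < k := by exact_mod_cast hk
  have hl0 : (0 : ℝ) < ℓ := by exact_mod_cast hl
  have hVpos : (0 : ℝ) < V.card := lt_of_lt_of_le (by positivity) hV
  obtain ⟨i0, hi0⟩ : V.Nonempty := by
    rw [← Finset.card_pos]; exact_mod_cast hVpos
  have hsub : ∀ i ∈ V, V.inf A ⊆ A i := fun i hi => Finset.inf_le hi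
  obtain ⟨c, hc, hcW⟩ : ∃ c ∈ V.inf A, c ∉ W := by
    by_contra h
    push Not at h
    have h1 : V.inf A ⊆ A i0 ∩ W := fun x hx =>
      Finset.mem_inter.2 ⟨hsub i0 hi0 hx, h x hx⟩
    have h2 := Finset.card_le_card h1
    have h3 := hcon i0 hi0
    omega
  have hle : delta n A W c ≤ deltaStar n A W :=
    Finset.le_sup' (delta n A W) (Finset.mem_univ c)
  have hterm : ∀ i, (if i ∈ V then (1 : ℝ) / ℓ else 0) ≤
      (∑ j ∈ Finset.Icc 1 ((A i ∩ insert c W).card), (1 : ℝ) / (j : ℝ)) -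
      ∑ j ∈ Finset.Icc 1 ((A i ∩ W).card), (1 : ℝ) / (j : ℝ) := by
    intro i
    split_ifs with hi
    · have hci : c ∈ A i := hsub i hi hc
      have hcard : (A i ∩ insert c W).card = (A i ∩ W).card + 1 := by
        rw [Finset.inter_insert_of_mem hci, Finset.card_insert_of_notMem]
        simp [hcW]
      rw [hcard, Finset.sum_Icc_succ_top (by omega), add_sub_cancel_left]
      apply one_div_le_one_div_of_le
      · positivity
      · exact_mod_cast hcon i hi
    · rw [sub_nonneg]
      apply Finset.sum_le_sum_of_subset_of_nonneg
      · apply Finset.Icc_subset_Icc_right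
        apply Finset.card_le_card
        exact Finset.inter_subset_inter_left (Finset.subset_insert c W)
      · intros
        positivity
  have hsum := Finset.sum_le_sum (fun i (_ : i ∈ (Finset.univ : Finset (Fin n))) => hterm i)
  rw [Finset.sum_sub_distrib] at hsum
  have hL : ∑ i : Fin n, (if i ∈ V then (1 : ℝ) / ℓ else 0) = V.card * (1 / ℓ) := by
    simp
  rw [hL] at hsum
  have hd : (1 / (n : ℝ)) * (V.card * (1 / ℓ)) ≤ delta n A W c := by
    unfold delta pavSc
    rw [← mul_sub]
    exact mul_le_mul_of_nonneg_left hsum (by positivity)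
  have hfin : 1 / (α * k) ≤ (1 / (n : ℝ)) * (V.card * (1 / ℓ)) := by
    calc 1 / (α * k) = (1 / (n : ℝ)) * ((((ℓ : ℝ) / α) * (n : ℝ) / (k : ℝ)) * (1 / ℓ)) := by
          field_simp
      _ ≤ _ := by gcongr
  linarith
end

section
/- For any committee W of size k ≥ 1 and any candidate c ∉ W, we have max_{x ∈ W} Δ(W,c,x) ≥ ((k+1)·Δ(W,c) − 1)/k. -/
open Finset

/-- `Δ(W,c',x) := pav-sc((W ∪ {c'}) \ {x}) − pav-sc(W)`. -/
noncomputable def deltaSwap {C : Type*} [DecidableEq C] (n : ℕ) (A : Fin n → Finset C)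
    (W : Finset C) (c' x : C) : ℝ :=
  pavSc n A ((W ∪ {c'}) \ {x}) - pavSc n A W

lemma voter_term {C : Type*} [DecidableEq C] (A S : Finset C) (x : C) (hx : x ∈ S) :
    (∑ j ∈ Finset.Icc 1 ((A ∩ S).card), (1 : ℝ) / (j : ℝ)) -
      ∑ j ∈ Finset.Icc 1 ((A ∩ (S \ {x})).card), (1 : ℝ) / (j : ℝ) =
      if x ∈ A then 1 / ((A ∩ S).card : ℝ) else 0 := by
  have h : A ∩ (S \ {x}) = (A ∩ S).erase x := by
    ext y; simp only [mem_inter, mem_sdiff, mem_singleton, mem_erase]; tauto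
  rw [h]
  split_ifs with hA
  · have hm : x ∈ A ∩ S := mem_inter.mpr ⟨hA, hx⟩
    have hcard := Finset.card_erase_add_one hm
    rw [← hcard, Finset.sum_Icc_succ_top (by omega)]
    ring
  · rw [Finset.erase_eq_of_notMem (by simp [hA])]
    ring

lemma voter_sum {C : Type*} [DecidableEq C] (A S : Finset C) :
    ∑ x ∈ S, ((∑ j ∈ Finset.Icc 1 ((A ∩ S).card), (1 : ℝ) / (j : ℝ)) -
      ∑ j ∈ Finset.Icc 1 ((A ∩ (S \ {x})).card), (1 : ℝ) / (j : ℝ)) ≤ 1 := by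
  rw [Finset.sum_congr rfl (fun x hx => voter_term A S x hx), ← Finset.sum_filter,
    Finset.filter_mem_eq_inter, Finset.inter_comm S A, Finset.sum_const, nsmul_eq_mul,
    mul_one_div]
  exact div_self_le_one _

lemma pav_sum {C : Type*} [DecidableEq C] (n : ℕ) (hn : 1 ≤ n) (A : Fin n → Finset C)
    (S : Finset C) : ∑ x ∈ S, (pavSc n A S - pavSc n A (S \ {x})) ≤ 1 := by
  have hn' : (0 : ℝ) < n := by exact_mod_cast hn
  unfold pavSc
  simp_rw [← mul_sub, ← Finset.sum_sub_distrib]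
  rw [← Finset.mul_sum, Finset.sum_comm, one_div, inv_mul_le_iff₀ hn']
  refine (Finset.sum_le_sum (fun i _ => ?_)).trans (b := ∑ _i : Fin n, (1 : ℝ)) (by simp)
  have := voter_sum (A i) S
  simpa only [Finset.sum_sub_distrib] using this

/-- For a committee `W` of size `k ≥ 1` and any candidate `c ∉ W`,
`max_{x ∈ W} Δ(W,c,x) ≥ ((k+1)·Δ(W,c) − 1)/k`. -/
theorem best_swap_lower_bound {C : Type*} [DecidableEq C]
    (n k : ℕ) (hn : 1 ≤ n) (hk : 1 ≤ k) (A : Fin n → Finset C)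
    (W : Finset C) (hW : W.card = k) (c : C) (hc : c ∉ W) :
    (((k : ℝ) + 1) * delta n A W c - 1) / (k : ℝ) ≤
      W.sup' (Finset.card_pos.mp (by omega)) (fun x => deltaSwap n A W c x) := by
  have hk' : (0 : ℝ) < k := by exact_mod_cast hk
  have h := pav_sum n hn A (insert c W)
  have hs : (insert c W) \ {c} = W := by
    ext y; simp only [mem_sdiff, mem_insert, mem_singleton]
    constructor
    · tauto
    · intro hy; exact ⟨Or.inr hy, fun e => hc (e ▸ hy)⟩
  have hu : W ∪ {c} = insert c W := by
    ext y; simp only [mem_union, mem_insert, mem_singleton]; tauto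
  rw [Finset.sum_insert hc, hs] at h
  rw [div_le_iff₀ hk']
  have hsup : ∑ x ∈ W, deltaSwap n A W c x ≤
      W.card • W.sup' (Finset.card_pos.mp (by omega)) (fun x => deltaSwap n A W c x) :=
    Finset.sum_le_card_nsmul _ _ _ (fun x hx => Finset.le_sup' (fun x => deltaSwap n A W c x) hx)
  have he : ∑ x ∈ W, deltaSwap n A W c x =
      k * delta n A W c - ∑ x ∈ W, (pavSc n A (insert c W) - pavSc n A (insert c W \ {x})) := by
    simp only [deltaSwap, delta, hu, Finset.sum_sub_distrib, Finset.sum_const, hW, nsmul_eq_mul]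
    ring
  rw [nsmul_eq_mul, he] at hsup
  have hW2 : (W.card : ℝ) = k := by rw [hW]
  generalize (W.card : ℝ) = w at hsup hW2
  subst hW2
  have hd : delta n A W c = pavSc n A (insert c W) - pavSc n A W := rfl
  linarith
end

section
/- Let 0 < α ≤ 1, let W be a committee of size k ≥ 1, and let c ∉ W be a candidate with Δ(W,c) ≥ 1/(αk). Then max_{x ∈ W} Δ(W,c,x) ≥ ((1−α)k + 1)/(α·k²). -/
open Finset

/-- The marginal contributions to one voter sum to at most one. -/
lemma voter_sum_le {C : Type*} [DecidableEq C] (B V : Finset C) :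
    ∑ x ∈ V, ((∑ j ∈ Finset.Icc 1 ((B ∩ V).card), (1 : ℝ) / (j : ℝ))
      - ∑ j ∈ Finset.Icc 1 ((B ∩ (V \ {x})).card), (1 : ℝ) / (j : ℝ)) ≤ 1 := by
  have key : ∀ x ∈ V, ((∑ j ∈ Finset.Icc 1 ((B ∩ V).card), (1 : ℝ) / (j : ℝ))
      - ∑ j ∈ Finset.Icc 1 ((B ∩ (V \ {x})).card), (1 : ℝ) / (j : ℝ))
      = if x ∈ B then 1 / ((B ∩ V).card : ℝ) else 0 := by
    intro x hx
    have e : B ∩ (V \ {x}) = (B ∩ V).erase x := by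
      ext y
      simp only [Finset.mem_inter, Finset.mem_sdiff, Finset.mem_singleton, Finset.mem_erase]
      tauto
    rw [e]
    split_ifs with hB
    · have hm : x ∈ B ∩ V := Finset.mem_inter.mpr ⟨hB, hx⟩
      rw [← Finset.card_erase_add_one hm, Finset.sum_Icc_succ_top (by omega)]
      ring
    · rw [Finset.erase_eq_of_notMem (by simp [hB])]
      ring
  rw [Finset.sum_congr rfl key, ← Finset.sum_filter, Finset.sum_const, nsmul_eq_mul]
  have e2 : V.filter (fun x => x ∈ B) = B ∩ V := by
    ext y
    simp only [Finset.mem_inter, Finset.mem_filter]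
    tauto
  rw [e2, mul_one_div]
  exact div_self_le_one _

/-- The marginal contributions of all members sum to at most one. -/
lemma pav_sum_le {C : Type*} [DecidableEq C] (n : ℕ) (hn : 1 ≤ n) (A : Fin n → Finset C)
    (V : Finset C) : ∑ x ∈ V, (pavSc n A V - pavSc n A (V \ {x})) ≤ 1 := by
  have hn' : (0 : ℝ) < n := by exact_mod_cast hn
  unfold pavSc
  simp_rw [← mul_sub, ← Finset.sum_sub_distrib]
  rw [← Finset.mul_sum, Finset.sum_comm]
  have h : ∑ i : Fin n, ∑ x ∈ V, ((∑ j ∈ Finset.Icc 1 ((A i ∩ V).card), (1 : ℝ) / (j : ℝ))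
      - ∑ j ∈ Finset.Icc 1 ((A i ∩ (V \ {x})).card), (1 : ℝ) / (j : ℝ)) ≤ ∑ i : Fin n, 1 :=
    Finset.sum_le_sum fun i _ => voter_sum_le (A i) V
  have h1 : (∑ i : Fin n, (1 : ℝ)) = n := by simp
  rw [h1] at h
  rw [one_div, inv_mul_le_iff₀ hn', mul_one]
  exact h

/-- For `0 < α ≤ 1`, a committee `W` of size `k ≥ 1`, and a candidate `c ∉ W` with
`Δ(W,c) ≥ 1/(αk)`, we have `max_{x ∈ W} Δ(W,c,x) ≥ ((1−α)k + 1)/(α·k²)`. -/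
theorem best_swap_lower_bound_of_large_delta {C : Type*} [DecidableEq C]
    (n k : ℕ) (hn : 1 ≤ n) (hk : 1 ≤ k) (A : Fin n → Finset C)
    (W : Finset C) (hW : W.card = k)
    (α : ℝ) (hα0 : 0 < α) (hα1 : α ≤ 1)
    (c : C) (hc : c ∉ W) (hΔ : 1 / (α * (k : ℝ)) ≤ delta n A W c) :
    ((1 - α) * (k : ℝ) + 1) / (α * (k : ℝ) ^ 2) ≤
      W.sup' (Finset.card_pos.mp (by omega)) (fun x => deltaSwap n A W c x) := by
  have hk' : (0 : ℝ) < k := by exact_mod_cast hk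
  have h := pav_sum_le n hn A (insert c W)
  rw [Finset.sum_insert hc] at h
  have e : insert c W \ {c} = W := by
    ext y
    simp only [Finset.mem_sdiff, Finset.mem_insert, Finset.mem_singleton]
    constructor
    · tauto
    · intro hy
      exact ⟨Or.inr hy, fun hyc => hc (hyc ▸ hy)⟩
  rw [e, Finset.sum_sub_distrib, Finset.sum_const, hW, nsmul_eq_mul] at h
  set M := W.sup' (Finset.card_pos.mp (by omega)) (fun x => deltaSwap n A W c x) with hM
  have hs : ∑ x ∈ W, deltaSwap n A W c x ≤ ∑ x ∈ W, M :=
    Finset.sum_le_sum fun x hx => Finset.le_sup' (fun x => deltaSwap n A W c x) hx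
  rw [Finset.sum_const, hW, nsmul_eq_mul] at hs
  unfold deltaSwap at hs
  rw [Finset.sum_sub_distrib, Finset.sum_const, hW, nsmul_eq_mul, Finset.union_comm W {c},
    ← Finset.insert_eq] at hs
  unfold delta at hΔ
  have h3 : ((k : ℝ) + 1) * (1 / (α * k)) ≤
      ((k : ℝ) + 1) * (pavSc n A (insert c W) - pavSc n A W) :=
    mul_le_mul_of_nonneg_left hΔ (by positivity)
  have h4 : ((k : ℝ) + 1) * (1 / (α * k)) - 1 ≤ k * M := by linarith
  have h5 : ((1 - α) * (k : ℝ) + 1) / (α * (k : ℝ) ^ 2)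
      = (((k : ℝ) + 1) * (1 / (α * k)) - 1) / k := by
    field_simp
    ring
  rw [h5, div_le_iff₀ hk']
  linarith
end

section
/- For any nonempty finite committee W⁺ ⊆ C, the sum over all x ∈ W⁺ of the marginal PAV-score losses satisfies Σ_{x ∈ W⁺} ( pav-sc(W⁺) − pav-sc(W⁺ \ {x}) ) ≤ 1. -/
open Finset

theorem voter_loss {C : Type*} [DecidableEq C] (B W : Finset C) :
    ∑ x ∈ W, (∑ j ∈ Finset.Icc 1 ((B ∩ W).card), (1 : ℝ) / (j : ℝ)
      - ∑ j ∈ Finset.Icc 1 ((B ∩ (W \ {x})).card), (1 : ℝ) / (j : ℝ)) ≤ 1 := by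
  have h : ∀ x ∈ W, (∑ j ∈ Finset.Icc 1 ((B ∩ W).card), (1 : ℝ) / (j : ℝ)
      - ∑ j ∈ Finset.Icc 1 ((B ∩ (W \ {x})).card), (1 : ℝ) / (j : ℝ))
      = if x ∈ B then 1 / ((B ∩ W).card : ℝ) else 0 := by
    intro x hx
    have e : B ∩ (W \ {x}) = (B ∩ W).erase x := by
      ext y
      simp only [mem_inter, mem_sdiff, mem_singleton, mem_erase]
      tauto
    rw [e]
    split_ifs with hB
    · have hm : x ∈ B ∩ W := mem_inter.2 ⟨hB, hx⟩
      have hc := card_erase_add_one hm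
      rw [← hc, Finset.sum_Icc_succ_top (by omega)]
      ring
    · rw [erase_eq_of_notMem (fun hm => hB (mem_inter.1 hm).1), sub_self]
  rw [Finset.sum_congr rfl h, ← Finset.sum_filter, Finset.filter_mem_eq_inter,
    Finset.sum_const, nsmul_eq_mul, Finset.inter_comm W B, mul_one_div]
  exact div_self_le_one _

/-- For any nonempty committee `W⁺`, the sum over all `x ∈ W⁺` of the marginal
PAV-score losses satisfies `Σ_{x ∈ W⁺} (pav-sc(W⁺) − pav-sc(W⁺ \ {x})) ≤ 1`. -/
theorem sum_marginal_losses_le_one {C : Type*} [DecidableEq C]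
    (n : ℕ) (hn : 1 ≤ n) (A : Fin n → Finset C)
    (Wplus : Finset C) (hWplus : Wplus.Nonempty) :
    ∑ x ∈ Wplus, (pavSc n A Wplus - pavSc n A (Wplus \ {x})) ≤ 1 := by
  have hn' : (0 : ℝ) < n := by exact_mod_cast hn
  simp only [pavSc, ← mul_sub, ← Finset.mul_sum, ← Finset.sum_sub_distrib]
  rw [Finset.sum_comm, one_div, inv_mul_le_iff₀ hn', mul_one]
  calc _ ≤ ∑ _i : Fin n, (1 : ℝ) := by
        refine Finset.sum_le_sum fun i _ => ?_
        exact voter_loss (A i) Wplus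
    _ = n := by simp
end

section
/- Let W be a committee of size k ≥ 1 such that for every candidate c ∉ W and every x ∈ W, Δ(W,c,x) < 1/k². Then Δ*(W) < 1/k. -/
open Finset

/-- Real harmonic sum. -/
noncomputable def hsum (m : ℕ) : ℝ := ∑ j ∈ Finset.Icc 1 m, (1 : ℝ) / (j : ℝ)

lemma hsum_succ (m : ℕ) : hsum (m + 1) = hsum m + 1 / ((m : ℝ) + 1) := by
  unfold hsum
  rw [Finset.sum_Icc_succ_top (by omega)]
  push_cast
  rfl

lemma voter_bound {C : Type*} [DecidableEq C] (B W : Finset C) (c : C) (hc : c ∉ W) :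
    ((W.card : ℝ) + 1) * (hsum (B ∩ insert c W).card - hsum (B ∩ W).card) - 1 ≤
      ∑ x ∈ W, (hsum (B ∩ ((W ∪ {c}) \ {x})).card - hsum (B ∩ W).card) := by
  have hcard : W.card = (W.filter (· ∈ B)).card + (W.filter (· ∉ B)).card :=
    (Finset.card_filter_add_card_filter_not (s := W) (fun x => x ∈ B)).symm
  have hBW : W.filter (· ∈ B) = B ∩ W := by ext; simp [and_comm]
  rw [hBW] at hcard
  rw [← Finset.sum_filter_add_sum_filter_not W (fun x => x ∈ B), hBW]
  have hU : W ∪ {c} = insert c W := by ext; simp [or_comm]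
  rw [hU]
  by_cases hcB : c ∈ B
  · have h1 : (B ∩ insert c W).card = (B ∩ W).card + 1 := by
      rw [Finset.inter_insert_of_mem hcB, Finset.card_insert_of_notMem (by simp [hc])]
    have e1 : ∀ x ∈ B ∩ W, hsum (B ∩ (insert c W \ {x})).card - hsum (B ∩ W).card = 0 := by
      intro x hx
      have : B ∩ (insert c W \ {x}) = (B ∩ insert c W).erase x := by
        ext; simp; tauto
      rw [this, Finset.card_erase_of_mem (by simp at hx ⊢; tauto), h1]
      simp
    have e2 : ∀ x ∈ W.filter (· ∉ B), hsum (B ∩ (insert c W \ {x})).card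
        - hsum (B ∩ W).card = 1 / (((B ∩ W).card : ℝ) + 1) := by
      intro x hx
      have : B ∩ (insert c W \ {x}) = (B ∩ insert c W).erase x := by
        ext; simp; tauto
      rw [this, Finset.erase_eq_of_notMem (by simp at hx ⊢; tauto), h1, hsum_succ]
      ring
    rw [Finset.sum_congr rfl e1, Finset.sum_congr rfl e2, h1, hsum_succ, hcard]
    simp only [Finset.sum_const, nsmul_eq_mul]
    push_cast
    apply le_of_eq
    have : ((B ∩ W).card : ℝ) + 1 ≠ 0 := by positivity
    field_simp
    ring
  · have h1 : B ∩ insert c W = B ∩ W := Finset.inter_insert_of_notMem hcB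
    have e2 : ∀ x ∈ W.filter (· ∉ B), hsum (B ∩ (insert c W \ {x})).card
        - hsum (B ∩ W).card = 0 := by
      intro x hx
      have : B ∩ (insert c W \ {x}) = (B ∩ insert c W).erase x := by
        ext; simp; tauto
      rw [this, h1, Finset.erase_eq_of_notMem (by simp at hx ⊢; tauto)]
      ring
    have e1 : ∀ x ∈ B ∩ W, hsum (B ∩ (insert c W \ {x})).card - hsum (B ∩ W).card
        = - (1 / ((B ∩ W).card : ℝ)) := by
      intro x hx
      have : B ∩ (insert c W \ {x}) = (B ∩ insert c W).erase x := by
        ext; simp; tauto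
      have hm := Finset.card_erase_add_one hx
      rw [this, h1, ← hm, hsum_succ]
      push_cast
      ring
    rw [Finset.sum_congr rfl e1, Finset.sum_congr rfl e2, h1]
    simp only [Finset.sum_const, nsmul_eq_mul]
    have := div_self_le_one ((B ∩ W).card : ℝ)
    have h3 : ((B ∩ W).card : ℝ) * -(1 / ((B ∩ W).card : ℝ))
      = - (((B ∩ W).card : ℝ) / ((B ∩ W).card : ℝ)) := by ring
    rw [h3]
    simp only [sub_self, mul_zero]
    linarith

/-- If no swap improves the PAV score of a size-`k` committee `W` by at least `1/k²`,
then `Δ*(W) < 1/k`. -/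
theorem no_good_swap_implies_low_deltaStar {C : Type*} [DecidableEq C] [Fintype C] [Nonempty C]
    (n k : ℕ) (hn : 1 ≤ n) (hk : 1 ≤ k) (A : Fin n → Finset C)
    (W : Finset C) (hW : W.card = k)
    (hswap : ∀ c : C, c ∉ W → ∀ x ∈ W, deltaSwap n A W c x < 1 / (k : ℝ) ^ 2) :
    deltaStar n A W < 1 / (k : ℝ) := by
  have hk0 : (0 : ℝ) < k := by exact_mod_cast hk
  have hn0 : (0 : ℝ) < n := by exact_mod_cast hn
  unfold deltaStar
  rw [Finset.sup'_lt_iff]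
  intro c _
  by_cases hc : c ∈ W
  · simp only [delta, Finset.insert_eq_of_mem hc, sub_self]
    positivity
  have hsc : ∀ S, pavSc n A S = (1 / (n : ℝ)) * ∑ i, hsum (A i ∩ S).card := fun _ => rfl
  have hlt : ∑ x ∈ W, deltaSwap n A W c x < ∑ x ∈ W, 1 / (k : ℝ) ^ 2 :=
    Finset.sum_lt_sum_of_nonempty (Finset.card_pos.mp (by omega)) (hswap c hc)
  have hge : ((k : ℝ) + 1) * delta n A W c - 1 ≤ ∑ x ∈ W, deltaSwap n A W c x := by
    have hs := Finset.sum_le_sum (s := Finset.univ)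
      (fun (i : Fin n) _ => voter_bound (A i) W c hc)
    rw [Finset.sum_comm] at hs
    simp only [deltaSwap, delta, hsc]
    simp only [← mul_sub, ← Finset.sum_sub_distrib, ← Finset.mul_sum]
    rw [Finset.sum_sub_distrib, ← Finset.mul_sum, hW] at hs
    simp only [Finset.sum_const, Finset.card_univ, Fintype.card_fin, nsmul_eq_mul,
      mul_one] at hs
    have h2 := mul_le_mul_of_nonneg_left hs (by positivity : (0 : ℝ) ≤ 1 / (n : ℝ))
    refine le_trans (le_of_eq ?_) h2
    field_simp
  rw [Finset.sum_const, hW, nsmul_eq_mul] at hlt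
  have h := lt_of_le_of_lt hge hlt
  have h4 : (k : ℝ) * (1 / (k : ℝ) ^ 2) = ((k : ℝ) + 1) * (1 / k) - 1 := by
    field_simp
    ring
  rw [h4] at h
  exact lt_of_mul_lt_mul_left (by linarith : ((k : ℝ) + 1) * delta n A W c < _) (by positivity)
end

section
/- Let W be a committee of size k ≥ 1 that maximizes the PAV score among all committees of size k (i.e., pav-sc(W) ≥ pav-sc(W') for every W' ⊆ C with |W'| = k). Then W satisfies EJR: for every integer ℓ ∈ {1,…,k} and every ℓ-large, ℓ-cohesive group of voters V, there exists a voter i ∈ V with |A_i ∩ W| ≥ ℓ. -/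
open Finset

/-- Harmonic sums. -/
noncomputable def harmS (m : ℕ) : ℝ := ∑ j ∈ Finset.Icc 1 m, (1 : ℝ) / (j : ℝ)

lemma harmS_succ (m : ℕ) : harmS (m + 1) = harmS m + 1 / ((m : ℝ) + 1) := by
  unfold harmS
  rw [Finset.sum_Icc_succ_top (by omega)]
  push_cast
  rfl

lemma harmS_mono : Monotone harmS := by
  apply monotone_nat_of_le_succ
  intro m
  rw [harmS_succ]
  have : (0 : ℝ) ≤ 1 / ((m : ℝ) + 1) := by positivity
  linarith

lemma swap_mem {C : Type*} [DecidableEq C] (B W : Finset C) (c w : C) (hc : c ∉ W)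
    (hcB : c ∈ B) :
    (if w ∈ B then (0 : ℝ) else 1 / (((B ∩ W).card : ℝ) + 1)) ≤
      harmS ((B ∩ insert c (W.erase w)).card) - harmS ((B ∩ W).card) := by
  have hcard : (B ∩ insert c (W.erase w)).card = ((B ∩ W).erase w).card + 1 := by
    rw [Finset.inter_insert_of_mem hcB, Finset.inter_erase, Finset.card_insert_of_notMem]
    simp [hc]
  split_ifs with h
  · have h1 : (B ∩ W).card ≤ (B ∩ insert c (W.erase w)).card := by
      have := Finset.pred_card_le_card_erase (s := B ∩ W) (a := w)
      omega
    have := harmS_mono h1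
    linarith
  · rw [hcard, Finset.erase_eq_of_notMem (by simp [h]), harmS_succ]
    linarith

lemma swap_any {C : Type*} [DecidableEq C] (B W : Finset C) (c w : C) (hw : w ∈ W) :
    (if w ∈ B then -(1 / ((B ∩ W).card : ℝ)) else 0) ≤
      harmS ((B ∩ insert c (W.erase w)).card) - harmS ((B ∩ W).card) := by
  have hle : ((B ∩ W).erase w).card ≤ (B ∩ insert c (W.erase w)).card := by
    apply Finset.card_le_card
    intro x
    simp only [Finset.mem_erase, Finset.mem_inter, Finset.mem_insert]
    tauto
  have hm := harmS_mono hle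
  split_ifs with h
  · have h1 : ((B ∩ W).erase w).card + 1 = (B ∩ W).card :=
      Finset.card_erase_add_one (by simp [h, hw])
    have h2 := harmS_succ ((B ∩ W).erase w).card
    have h3 : (((B ∩ W).erase w).card : ℝ) + 1 = ((B ∩ W).card : ℝ) := by exact_mod_cast h1
    rw [h1, h3] at h2
    linarith
  · rw [Finset.erase_eq_of_notMem (by simp [h])] at hm
    linarith

lemma sum_swap_mem {C : Type*} [DecidableEq C] (B W : Finset C) (c : C) (hc : c ∉ W)
    (hcB : c ∈ B) (l : ℕ) (hl : (B ∩ W).card < l) :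
    ((W.card : ℝ) + 1) / l - 1 ≤
      ∑ w ∈ W, (harmS ((B ∩ insert c (W.erase w)).card) - harmS ((B ∩ W).card)) := by
  refine le_trans ?_ (Finset.sum_le_sum fun w _ => swap_mem B W c w hc hcB)
  rw [← Finset.sum_filter_add_sum_filter_not W (fun w => w ∈ B)]
  rw [Finset.sum_congr rfl (g := fun _ => (0 : ℝ)) (by intro x hx; simp_all)]
  rw [Finset.sum_congr (s₁ := W.filter (fun w => ¬ w ∈ B)) rfl
    (g := fun _ => 1 / (((B ∩ W).card : ℝ) + 1)) (by intro x hx; simp_all)]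
  have e : W.filter (fun w => w ∈ B) = B ∩ W := by ext x; simp [and_comm]
  have hs := Finset.card_filter_add_card_filter_not (s := W) (fun w => w ∈ B)
  rw [e] at hs
  have hs' : ((W.filter (fun w => ¬ w ∈ B)).card : ℝ) = W.card - (B ∩ W).card := by
    rw [← hs]; push_cast; ring
  simp only [Finset.sum_const, nsmul_eq_mul, hs', mul_zero, zero_add]
  have hu : ((B ∩ W).card : ℝ) + 1 ≤ l := by exact_mod_cast hl
  have hpos : (0 : ℝ) < ((B ∩ W).card : ℝ) + 1 := by positivity
  have : ((W.card : ℝ) + 1) / l ≤ ((W.card : ℝ) + 1) / (((B ∩ W).card : ℝ) + 1) := by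
    gcongr
  have e2 : ((W.card : ℝ) - (B ∩ W).card) * (1 / (((B ∩ W).card : ℝ) + 1)) =
      ((W.card : ℝ) + 1) / (((B ∩ W).card : ℝ) + 1) - 1 := by
    field_simp
    ring
  rw [e2]
  linarith

lemma sum_swap_any {C : Type*} [DecidableEq C] (B W : Finset C) (c : C) :
    -1 ≤ ∑ w ∈ W, (harmS ((B ∩ insert c (W.erase w)).card) - harmS ((B ∩ W).card)) := by
  refine le_trans ?_ (Finset.sum_le_sum fun w hw => swap_any B W c w hw)
  rw [← Finset.sum_filter]
  have e : W.filter (fun w => w ∈ B) = B ∩ W := by ext x; simp [and_comm]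
  rw [e, Finset.sum_const, nsmul_eq_mul]
  rcases Nat.eq_zero_or_pos (B ∩ W).card with h | h
  · simp [h]
  · have : ((B ∩ W).card : ℝ) ≠ 0 := by positivity
    field_simp
    rfl

/-- A committee `W` of size `k ≥ 1` maximizing the PAV score among all committees of
size `k` satisfies EJR: for every `ℓ ∈ {1,…,k}` and every `ℓ`-large, `ℓ`-cohesive group
of voters `V`, some voter `i ∈ V` approves at least `ℓ` members of `W`. -/
theorem pav_maximizer_satisfies_EJR {C : Type*} [DecidableEq C] [Fintype C]
    (n k : ℕ) (hn : 1 ≤ n) (hk : 1 ≤ k) (hkC : k ≤ Fintype.card C)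
    (A : Fin n → Finset C) (W : Finset C) (hW : W.card = k)
    (hmax : ∀ W' : Finset C, W'.card = k → pavSc n A W' ≤ pavSc n A W) :
    ∀ ℓ : ℕ, 1 ≤ ℓ → ℓ ≤ k → ∀ V : Finset (Fin n),
      (ℓ : ℝ) * (n : ℝ) / (k : ℝ) ≤ (V.card : ℝ) →
      ℓ ≤ (V.inf A).card →
      ∃ i ∈ V, ℓ ≤ (A i ∩ W).card := by
  intro ℓ hl hlk V hV hcoh
  by_contra! hcon
  have hn0 : (0 : ℝ) < n := by exact_mod_cast hn
  have hk0 : (0 : ℝ) < k := by exact_mod_cast hk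
  have hl0 : (0 : ℝ) < ℓ := by exact_mod_cast hl
  have hVpos : (0 : ℝ) < V.card := lt_of_lt_of_le (by positivity) hV
  obtain ⟨i0, hi0⟩ : V.Nonempty := Finset.card_pos.mp (by exact_mod_cast hVpos)
  obtain ⟨c, hcI, hcW⟩ : ∃ c ∈ V.inf A, c ∉ W := by
    by_contra! h
    have hsub : V.inf A ⊆ A i0 ∩ W := by
      intro x hx
      exact Finset.mem_inter.mpr ⟨(Finset.inf_le hi0 : V.inf A ≤ A i0) hx, h x hx⟩
    have := Finset.card_le_card hsub
    have := hcon i0 hi0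
    omega
  have hswap : ∀ w ∈ W,
      ∑ i, (harmS ((A i ∩ insert c (W.erase w)).card) - harmS ((A i ∩ W).card)) ≤ 0 := by
    intro w hw
    have hc : (insert c (W.erase w)).card = k := by
      rw [Finset.card_insert_of_notMem (by simp [hcW]), Finset.card_erase_add_one hw, hW]
    have h := hmax _ hc
    unfold pavSc at h
    have h' := le_of_mul_le_mul_left h (by positivity)
    rw [Finset.sum_sub_distrib]
    unfold harmS
    linarith
  have htot := Finset.sum_nonpos hswap
  rw [Finset.sum_comm] at htot
  have hlow : ∑ i : Fin n, ((if i ∈ V then ((k : ℝ) + 1) / ℓ else 0) - 1) ≤ 0 := by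
    refine le_trans (Finset.sum_le_sum fun i _ => ?_) htot
    split_ifs with hi
    · have := sum_swap_mem (A i) W c hcW ((Finset.inf_le hi : V.inf A ≤ A i) hcI) ℓ (hcon i hi)
      rwa [hW] at this
    · have := sum_swap_any (A i) W c
      linarith
  rw [Finset.sum_sub_distrib] at hlow
  simp only [Finset.sum_ite_mem, Finset.univ_inter, Finset.sum_const, nsmul_eq_mul,
    Finset.card_univ, Fintype.card_fin, mul_one] at hlow
  have h1 : (ℓ : ℝ) * n / k * (((k : ℝ) + 1) / ℓ) ≤ V.card * (((k : ℝ) + 1) / ℓ) := by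
    gcongr
  have h2 : (ℓ : ℝ) * n / k * (((k : ℝ) + 1) / ℓ) = n + n / k := by
    field_simp
  have h3 : (0 : ℝ) < n / k := by positivity
  linarith
end

section
/- Let W be a committee of size k ≥ 1 that maximizes the PAV score among all committees of size k (i.e., pav-sc(W) ≥ pav-sc(W') for every W' ⊆ C with |W'| = k). Then W satisfies OAS: for every real λ ∈ [0,k] and every (λ+1)-large, λ-cohesive group of voters V, the average satisfaction satisfies avs_W(V) ≥ λ. -/
open Finset

/-- Unnormalised PAV score. -/
noncomputable def pavTot {C : Type*} [DecidableEq C] (n : ℕ) (A : Fin n → Finset C)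
    (W : Finset C) : ℝ :=
  ∑ i, ∑ j ∈ Finset.Icc 1 ((A i ∩ W).card), (1 : ℝ) / (j : ℝ)

lemma pavTot_insert {C : Type*} [DecidableEq C] (n : ℕ) (A : Fin n → Finset C)
    (U : Finset C) (x : C) (hx : x ∉ U) :
    pavTot n A (insert x U) = pavTot n A U +
      ∑ i, (if x ∈ A i then 1 / (((A i ∩ insert x U).card : ℕ) : ℝ) else 0) := by
  unfold pavTot
  rw [← Finset.sum_add_distrib]
  refine Finset.sum_congr rfl fun i _ => ?_
  by_cases h : x ∈ A i
  · rw [if_pos h, Finset.inter_insert_of_mem h, Finset.card_insert_of_notMem (by simp [hx]),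
      Finset.sum_Icc_succ_top (by omega)]
  · rw [if_neg h, Finset.inter_insert_of_notMem h, add_zero]

/-- A committee `W` of size `k ≥ 1` maximizing the PAV score among all committees of
size `k` satisfies OAS: for every real `λ ∈ [0,k]` and every `(λ+1)`-large,
`λ`-cohesive group of voters `V`, the average satisfaction of `V` for `W` is at
least `λ`. -/
theorem pav_maximizer_satisfies_OAS {C : Type*} [DecidableEq C] [Fintype C]
    (n k : ℕ) (hn : 1 ≤ n) (hk : 1 ≤ k) (hkC : k ≤ Fintype.card C)
    (A : Fin n → Finset C) (W : Finset C) (hW : W.card = k)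
    (hmax : ∀ W' : Finset C, W'.card = k → pavSc n A W' ≤ pavSc n A W) :
    ∀ lam : ℝ, 0 ≤ lam → lam ≤ (k : ℝ) → ∀ V : Finset (Fin n),
      (lam + 1) * (n : ℝ) / (k : ℝ) ≤ (V.card : ℝ) →
      lam ≤ ((V.inf A).card : ℝ) →
      lam ≤ (1 / (V.card : ℝ)) * ∑ i ∈ V, ((A i ∩ W).card : ℝ) := by
  intro lam h0 hlk V hV hcoh
  have hn' : (0:ℝ) < n := by exact_mod_cast hn
  have hk' : (0:ℝ) < k := by exact_mod_cast hk
  have hVpos : (0:ℝ) < V.card := lt_of_lt_of_le (by positivity) hV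
  by_contra hcon
  rw [not_le, one_div, inv_mul_lt_iff₀ hVpos] at hcon
  have hmem : ∀ i ∈ V, V.inf A ⊆ A i := fun i hi => Finset.inf_le hi
  by_cases hsub : V.inf A ⊆ W
  · have : ∑ i ∈ V, lam ≤ ∑ i ∈ V, ((A i ∩ W).card : ℝ) := by
      refine Finset.sum_le_sum fun i hi => hcoh.trans ?_
      exact_mod_cast Finset.card_le_card (Finset.subset_inter (hmem i hi) hsub)
    rw [Finset.sum_const, nsmul_eq_mul] at this
    linarith
  obtain ⟨c, hcV, hcW⟩ := Finset.not_subset.mp hsub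
  have hmax' : ∀ W' : Finset C, W'.card = k → pavTot n A W' ≤ pavTot n A W := by
    intro W' h
    have := hmax W' h
    unfold pavSc at this
    exact le_of_mul_le_mul_left this (by positivity)
  have hadd := pavTot_insert n A W c hcW
  set gain := ∑ i, (if c ∈ A i then 1 / (((A i ∩ insert c W).card : ℕ) : ℝ) else 0) with hgain
  -- lower bound on the gain
  have hg1 : (n:ℝ) / k < gain := by
    have hm : 0 < lam + 1 := by linarith
    have h1 : ∑ i ∈ V, (2 / (lam+1) - (((A i ∩ W).card : ℝ) + 1) / (lam+1)^2) ≤ gain := by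
      rw [hgain]
      refine le_trans (Finset.sum_le_sum (g := fun i =>
        (if c ∈ A i then 1 / (((A i ∩ insert c W).card : ℕ) : ℝ) else 0)) fun i hi => ?_)
        (Finset.sum_le_sum_of_subset_of_nonneg (Finset.subset_univ V)
          fun i _ _ => by positivity)
      have hc := hmem i hi hcV
      simp only [if_pos hc]
      rw [Finset.inter_insert_of_mem hc, Finset.card_insert_of_notMem (by simp [hcW])]
      push_cast
      have hx : (0:ℝ) < ((A i ∩ W).card : ℝ) + 1 := by positivity
      generalize ((A i ∩ W).card : ℝ) + 1 = x at hx
      generalize lam + 1 = m at hm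
      have : 1 / x - (2 / m - x / m^2) = (x - m)^2 / (x * m^2) := by
        field_simp
        ring
      have h2 : 0 ≤ (x - m)^2 / (x * m^2) := by positivity
      linarith
    simp only [Finset.sum_sub_distrib, ← Finset.sum_div, Finset.sum_add_distrib, Finset.sum_const, nsmul_eq_mul, mul_one] at h1
    have h3 : (∑ i ∈ V, ((A i ∩ W).card : ℝ) + V.card) / (lam+1)^2 < V.card / (lam+1) := by
      rw [div_lt_div_iff₀ (by positivity) hm]
      nlinarith
    have h4 : (n:ℝ) / k ≤ V.card / (lam+1) := by
      rw [le_div_iff₀ hm]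
      calc (n:ℝ) / k * (lam+1) = (lam + 1) * n / k := by ring
        _ ≤ _ := hV
    have h5 : (V.card:ℝ) * 2 / (lam+1) = V.card / (lam+1) + V.card / (lam+1) := by ring
    linarith
  -- removing some member costs little
  have hloss : ∀ d ∈ W, gain ≤
      ∑ i, (if d ∈ A i then 1 / (((A i ∩ insert c W).card : ℕ) : ℝ) else 0) := by
    intro d hd
    have hd' : d ∈ insert c W := Finset.mem_insert_of_mem hd
    have h1 := pavTot_insert n A ((insert c W).erase d) d (Finset.notMem_erase _ _)
    rw [Finset.insert_erase hd'] at h1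
    have h2 := hmax' ((insert c W).erase d) (by
      rw [Finset.card_erase_of_mem hd', Finset.card_insert_of_notMem hcW]; omega)
    linarith
  have hsum := Finset.sum_le_sum hloss
  rw [Finset.sum_const, nsmul_eq_mul, hW, Finset.sum_comm] at hsum
  have hle : ∑ i, ∑ d ∈ W,
      (if d ∈ A i then 1 / (((A i ∩ insert c W).card : ℕ) : ℝ) else 0) ≤ ∑ i : Fin n, (1:ℝ) := by
    refine Finset.sum_le_sum fun i _ => ?_
    rw [← Finset.sum_filter, Finset.sum_const, nsmul_eq_mul, mul_one_div]
    refine div_le_one_of_le₀ ?_ (by positivity)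
    norm_cast
    refine Finset.card_le_card fun d hd => ?_
    simp only [Finset.mem_filter] at hd
    simp [hd.1, hd.2]
  rw [Finset.sum_const, Finset.card_univ, Fintype.card_fin, nsmul_eq_mul, mul_one] at hle
  rw [div_lt_iff₀ hk'] at hg1
  linarith
end

section
/- Let k and t be integers with 2 ≤ t < k and t ≥ 2k/3, and let x_1 ≥ x_2 ≥ … ≥ x_t be a weakly decreasing sequence of real numbers with x_i ≥ 1/k for every i ∈ {1,…,t}. Then Σ_{i=1}^{t} x_i + (k − t)·(2/k − x_{⌊t/2⌋}) ≥ 1. -/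
open Finset

/-- Counting argument for the non-adaptive greedy algorithm: for integers `2 ≤ t < k`
with `t ≥ 2k/3` and a weakly decreasing sequence `x_1 ≥ … ≥ x_t` with each `x_i ≥ 1/k`,
we have `Σ_{i=1}^{t} x_i + (k − t)·(2/k − x_{⌊t/2⌋}) ≥ 1`. -/
theorem greedy_counting_inequality (k t : ℕ) (ht2 : 2 ≤ t) (htk : t < k)
    (h23 : 2 * (k : ℝ) / 3 ≤ (t : ℝ))
    (x : ℕ → ℝ)
    (hdec : ∀ i j : ℕ, 1 ≤ i → i ≤ j → j ≤ t → x j ≤ x i)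
    (hlb : ∀ i : ℕ, 1 ≤ i → i ≤ t → 1 / (k : ℝ) ≤ x i) :
    1 ≤ ∑ i ∈ Finset.Icc 1 t, x i + ((k : ℝ) - (t : ℝ)) * (2 / (k : ℝ) - x (t / 2)) := by
  have hk : (0 : ℝ) < k := by exact_mod_cast (by omega : 0 < k)
  have h3 : 2 * k ≤ 3 * t := by
    have : 2 * (k : ℝ) ≤ 3 * t := by linarith
    exact_mod_cast this
  obtain ⟨m, hm⟩ : ∃ m, m = t / 2 := ⟨_, rfl⟩
  rw [← hm]
  have hm1 : 1 ≤ m := by omega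
  have hmt : m ≤ t := by omega
  have hkm : (k : ℝ) ≤ m + t := by exact_mod_cast (by omega : k ≤ m + t)
  have hsplit : ∑ i ∈ Finset.Icc 1 t, x i
      = ∑ i ∈ Finset.Icc 1 m, x i + ∑ i ∈ Finset.Ioc m t, x i := by
    rw [← Finset.sum_union]
    · congr 1
      ext i
      simp only [Finset.mem_union, Finset.mem_Icc, Finset.mem_Ioc]
      omega
    · rw [Finset.disjoint_left]
      intro i
      simp only [Finset.mem_Icc, Finset.mem_Ioc]
      omega
  have h1 : (m : ℝ) * x m ≤ ∑ i ∈ Finset.Icc 1 m, x i := by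
    have := Finset.card_nsmul_le_sum (Finset.Icc 1 m) x (x m) (by
      intro i hi
      rw [Finset.mem_Icc] at hi
      exact hdec i m hi.1 hi.2 hmt)
    simpa using this
  have h2 : ((t : ℝ) - m) * (1 / k) ≤ ∑ i ∈ Finset.Ioc m t, x i := by
    have := Finset.card_nsmul_le_sum (Finset.Ioc m t) x (1 / (k : ℝ)) (by
      intro i hi
      rw [Finset.mem_Ioc] at hi
      exact hlb i (by omega) hi.2)
    rw [Nat.card_Ioc, nsmul_eq_mul, Nat.cast_sub hmt] at this
    exact this
  have h4 := mul_le_mul_of_nonneg_left (hlb m hm1 hmt) (by linarith : (0 : ℝ) ≤ m + t - k)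
  have h5 : (k : ℝ) * (1 / k) = 1 := by field_simp
  have h6 : 2 / (k : ℝ) = 2 * (1 / k) := by ring
  rw [hsplit, h6]
  nlinarith [h1, h2, h4, h5]
end

section
/- There exists a probability distribution (x_S)_{S ⊆ {1,…,7}} over the subsets of {1,…,7} (that is, x_S ≥ 0 for all S and Σ_{S ⊆ {1,…,7}} x_S = 1) such that: (1) for any two sets T₁, T₂ ⊆ {1,…,7} with |T₁| = |T₂| ≤ 2, Σ_{S ⊇ T₁} x_S = Σ_{S ⊇ T₂} x_S; and (2) x_{{1}} ≥ 1/6. -/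
open Finset

/-- Integer weights (in units of `1/90`). -/
def advWeight (S : Finset (Fin 7)) : ℕ :=
  if (0 : Fin 7) ∈ S then (if S.card = 1 then 15 else if S.card = 5 then 1 else 0)
  else (if S.card = 2 then 4 else 0)

/-- The marginal value as a function of the order. -/
def advMarginal (n : ℕ) : ℕ := if n = 0 then 90 else if n = 1 then 30 else 10

lemma advWeight_marginal : ∀ T : Finset (Fin 7), T.card ≤ 2 →
    ∑ S ∈ Finset.univ.filter (fun S => T ⊆ S), advWeight S = advMarginal T.card := by
  decide +kernel

lemma advWeight_total : ∑ S : Finset (Fin 7), advWeight S = 90 := by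
  decide +kernel

/-- There is a probability distribution over the subsets of a 7-element set such that
all marginals of order at most 2 are uniform across index sets of equal size, and the
singleton `{1}` (here `{0} : Finset (Fin 7)`) has probability at least `1/6`. -/
theorem exists_adversarial_distribution_seven :
    ∃ x : Finset (Fin 7) → ℝ,
      (∀ S : Finset (Fin 7), 0 ≤ x S) ∧
      (∑ S : Finset (Fin 7), x S = 1) ∧
      (∀ T₁ T₂ : Finset (Fin 7), T₁.card = T₂.card → T₁.card ≤ 2 →
        ∑ S ∈ Finset.univ.filter (fun S => T₁ ⊆ S), x S =
        ∑ S ∈ Finset.univ.filter (fun S => T₂ ⊆ S), x S) ∧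
      1 / 6 ≤ x {0} := by
  refine ⟨fun S => (advWeight S : ℝ) / 90, fun S => by positivity, ?_, ?_, ?_⟩
  · rw [← Finset.sum_div, ← Nat.cast_sum, advWeight_total]
    norm_num
  · intro T₁ T₂ h h2
    rw [← Finset.sum_div, ← Finset.sum_div, ← Nat.cast_sum, ← Nat.cast_sum,
      advWeight_marginal T₁ h2, advWeight_marginal T₂ (h ▸ h2), h]
  · norm_num [advWeight]
end
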